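/- arXiv:1601.07087 — 6 statements merged into one kernel-verified Lean document; each statement's English description precedes it below -/
import Mathlib

section
/- Let Φ ∈ K^{m×n}, let X₀ ∈ K^{n×l} have support Ω := supp(X₀), let Ω_c ⊆ {1,…,n} satisfy Ω ⊆ Ω_c, and assume Φ_{Ω_c} has full column rank, i.e. σ_{|Ω_c|}(Φ_{Ω_c}) > 0. Let W ∈ K^{m×l} and Y := Φ X₀ + W. If min_{a ∈ Ω} ‖X₀^{{a}}‖₂ > 2 · max_{c ∈ Ω_c} ‖(Φ_{Ω_c}^† W)^{{c}}‖₂, then min_{a ∈ Ω} ‖(Φ_{Ω_c}^† Y)^{{a}}‖₂ > max_{b ∈ Ω_c \ Ω} ‖(Φ_{Ω_c}^† Y)^{{b}}‖₂; in particular the indices of the |Ω| rows of Φ_{Ω_c}^† Y with largest ℓ₂-norm are exactly Ω. -/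
open scoped Matrix

noncomputable section

variable {𝕜 : Type*} [RCLike 𝕜]

/-- The `i`-th largest singular value (1-indexed) of a matrix, via the
Courant–Fischer max–min characterization. -/
def sval {m n : ℕ} (A : Matrix (Fin m) (Fin n) 𝕜) (i : ℕ) : ℝ :=
  sSup { t : ℝ | 0 ≤ t ∧ ∃ S : Submodule 𝕜 (EuclideanSpace 𝕜 (Fin n)),
    Module.finrank 𝕜 S = i ∧ ∀ x ∈ S, t * ‖x‖ ≤ ‖Matrix.toEuclideanLin A x‖ }

/-- Submatrix of columns indexed by the finset `J` (in increasing order). -/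
def colSub {m n : ℕ} (A : Matrix (Fin m) (Fin n) 𝕜) (J : Finset (Fin n)) :
    Matrix (Fin m) (Fin J.card) 𝕜 :=
  A.submatrix id (fun j => J.orderEmbOfFin rfl j)

/-- Submatrix of rows indexed by the finset `J` (in increasing order). -/
def rowSub {m n : ℕ} (A : Matrix (Fin m) (Fin n) 𝕜) (J : Finset (Fin m)) :
    Matrix (Fin J.card) (Fin n) 𝕜 :=
  A.submatrix (fun i => J.orderEmbOfFin rfl i) id

/-- Moore–Penrose pseudoinverse (valid formula in the full-column-rank case,
which holds in every statement where it is used). -/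
def pinv {m n : ℕ} (A : Matrix (Fin m) (Fin n) 𝕜) : Matrix (Fin n) (Fin m) 𝕜 :=
  (Aᴴ * A)⁻¹ * Aᴴ

open Classical in
/-- The set of indices of nonzero rows of a matrix. -/
def rowSupport {n l : ℕ} (X : Matrix (Fin n) (Fin l) 𝕜) : Finset (Fin n) :=
  Finset.univ.filter (fun i => X i ≠ 0)

/-- Column space (range) of a matrix, as a submodule of Euclidean space. -/
def mrange {m : ℕ} {ι : Type*} [Fintype ι] [DecidableEq ι]
    (A : Matrix (Fin m) ι 𝕜) : Submodule 𝕜 (EuclideanSpace 𝕜 (Fin m)) :=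
  LinearMap.range (Matrix.toEuclideanLin A)

/-- Orthogonal projection onto a subspace, as an endomorphism. -/
def proj {m : ℕ} (S : Submodule 𝕜 (EuclideanSpace 𝕜 (Fin m))) :
    EuclideanSpace 𝕜 (Fin m) →L[𝕜] EuclideanSpace 𝕜 (Fin m) :=
  S.subtypeL.comp (Submodule.orthogonalProjectionOnto S)

/-- The `i`-th column of a matrix, as an element of Euclidean space. -/
def col {m n : ℕ} (A : Matrix (Fin m) (Fin n) 𝕜) (i : Fin n) :
    EuclideanSpace 𝕜 (Fin m) :=
  (WithLp.equiv 2 (Fin m → 𝕜)).symm (fun r => A r i)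

/-- The normalized projection `φ̇_i` of the `i`-th column of `Φ` onto the
orthogonal complement of the range of `Φ_Γ` (zero if the projection vanishes). -/
def ndot {m n : ℕ} (Φ : Matrix (Fin m) (Fin n) 𝕜) (Γ : Finset (Fin n)) (i : Fin n) :
    EuclideanSpace 𝕜 (Fin m) :=
  ‖proj (mrange (colSub Φ Γ))ᗮ (col Φ i)‖⁻¹ • proj (mrange (colSub Φ Γ))ᗮ (col Φ i)

/-- The matrix `Φ̇_J` whose columns are the `φ̇_i`, `i ∈ J`. -/
def ndotMat {m n : ℕ} (Φ : Matrix (Fin m) (Fin n) 𝕜) (Γ J : Finset (Fin n)) :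
    Matrix (Fin m) (Fin J.card) 𝕜 :=
  fun r j => ndot Φ Γ (J.orderEmbOfFin rfl j) r

/-- Kruskal rank: the maximal `q` such that every `q` columns are linearly
independent. -/
def krank {ρ ι : Type*} [Fintype ι] (A : Matrix ρ ι 𝕜) : ℕ :=
  sSup {q : ℕ | q ≤ Fintype.card ι ∧ ∀ J : Finset ι, J.card = q →
    LinearIndependent 𝕜 (fun j : J => Aᵀ j.1)}

/-- `X` is row-nondegenerate if `krank (Xᴴ) = rank X`. -/
def rowNondegenerate {n l : ℕ} (X : Matrix (Fin n) (Fin l) 𝕜) : Prop :=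
  krank Xᴴ = X.rank

/-- ℓ₂ norm of the `i`-th row of a matrix. -/
def rowNorm {n l : ℕ} (A : Matrix (Fin n) (Fin l) 𝕜) (i : Fin n) : ℝ :=
  Real.sqrt (∑ j, ‖A i j‖ ^ 2)


open scoped ComplexOrder in
theorem aux_pinv_mul {m n : ℕ} (A : Matrix (Fin m) (Fin n) 𝕜) (h : 0 < sval A n) :
    pinv A * A = 1 := by
  have hne : { t : ℝ | 0 ≤ t ∧ ∃ S : Submodule 𝕜 (EuclideanSpace 𝕜 (Fin n)),
      Module.finrank 𝕜 S = n ∧ ∀ x ∈ S, t * ‖x‖ ≤ ‖Matrix.toEuclideanLin A x‖ }.Nonempty := by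
    by_contra hc
    rw [Set.not_nonempty_iff_eq_empty] at hc
    unfold sval at h
    rw [hc] at h
    simp at h
  obtain ⟨t, ⟨-, S, hS, hx⟩, ht⟩ := exists_lt_of_lt_csSup hne h
  have hS' : S = ⊤ := by
    apply Submodule.eq_top_of_finrank_eq
    rw [hS]; simp
  subst hS'
  have hinj : Function.Injective A.mulVec := by
    have : Function.Injective (Matrix.mulVecLin A) := by
      rw [← LinearMap.ker_eq_bot, LinearMap.ker_eq_bot']
      intro v hv
      have h1 := hx (WithLp.toLp 2 v) trivial
      have h2 : Matrix.toEuclideanLin A (WithLp.toLp 2 v) = 0 := by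
        rw [Matrix.toEuclideanLin_toLp]
        simpa using hv
      rw [h2, norm_zero] at h1
      have h3 : ‖WithLp.toLp 2 v‖ = 0 := by
        have := norm_nonneg (WithLp.toLp 2 v)
        nlinarith
      simpa using h3
    exact this
  have hu : IsUnit (Aᴴ * A) := (Matrix.PosDef.conjTranspose_mul_self A hinj).isUnit
  unfold pinv
  rw [Matrix.mul_assoc]
  exact Matrix.nonsing_inv_mul _ ((Matrix.isUnit_iff_isUnit_det _).1 hu)

theorem aux_rowNorm {n l : ℕ} (A : Matrix (Fin n) (Fin l) 𝕜) (i : Fin n) :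
    rowNorm A i = ‖(WithLp.toLp 2 (A i) : EuclideanSpace 𝕜 (Fin l))‖ := by
  rw [EuclideanSpace.norm_eq]; rfl

theorem aux_colSub_mul {m n l : ℕ} (Φ : Matrix (Fin m) (Fin n) 𝕜)
    (X : Matrix (Fin n) (Fin l) 𝕜) (J : Finset (Fin n)) (hJ : ∀ i, i ∉ J → X i = 0) :
    Φ * X = colSub Φ J * rowSub X J := by
  ext i k
  simp only [Matrix.mul_apply, colSub, rowSub, Matrix.submatrix_apply, id]
  have h1 : ∑ j, Φ i j * X j k = ∑ j ∈ J, Φ i j * X j k := by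
    symm
    apply Finset.sum_subset (Finset.subset_univ J)
    intro j _ hj
    simp [hJ j hj]
  rw [h1, ← Finset.sum_coe_sort J (fun j => Φ i j * X j k)]
  symm
  exact Fintype.sum_equiv (J.orderIsoOfFin rfl).toEquiv _ _ (fun j => rfl)

/-- If the smallest row-norm of `X₀` on its support exceeds
twice the largest row-norm of `Φ_{Ω_c}† W`, then the rows of `Φ_{Ω_c}† Y`
indexed by `Ω` have strictly larger ℓ₂ norm than those indexed by `Ω_c \ Ω`. -/
theorem statement1 {m n l : ℕ} (Φ : Matrix (Fin m) (Fin n) 𝕜)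
    (X₀ : Matrix (Fin n) (Fin l) 𝕜) (W Y : Matrix (Fin m) (Fin l) 𝕜)
    (Ω Ωc : Finset (Fin n)) (hΩ : rowSupport X₀ = Ω) (hsub : Ω ⊆ Ωc)
    (hrank : 0 < sval (colSub Φ Ωc) Ωc.card)
    (hY : Y = Φ * X₀ + W)
    (hgap : ∀ a ∈ Ω, ∀ c : Fin Ωc.card,
      2 * rowNorm (pinv (colSub Φ Ωc) * W) c < rowNorm X₀ a) :
    ∀ a, ∀ ha : a ∈ Ω, ∀ b, ∀ hb : b ∈ Ωc, b ∉ Ω →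
      rowNorm (pinv (colSub Φ Ωc) * Y) ((Ωc.orderIsoOfFin rfl).symm ⟨b, hb⟩) <
      rowNorm (pinv (colSub Φ Ωc) * Y) ((Ωc.orderIsoOfFin rfl).symm ⟨a, hsub ha⟩) := by
  intro a ha b hb hbΩ
  have hzero : ∀ i, i ∉ Ω → X₀ i = 0 := by
    intro i hi
    by_contra hc
    apply hi
    rw [← hΩ]
    simp [rowSupport, hc]
  have key : pinv (colSub Φ Ωc) * Y = rowSub X₀ Ωc + pinv (colSub Φ Ωc) * W := by
    rw [hY, aux_colSub_mul Φ X₀ Ωc (fun i hi => hzero i (fun h => hi (hsub h))), Matrix.mul_add,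
      ← Matrix.mul_assoc, aux_pinv_mul _ hrank, Matrix.one_mul]
  have hrow : ∀ c (hc : c ∈ Ωc),
      rowSub X₀ Ωc ((Ωc.orderIsoOfFin rfl).symm ⟨c, hc⟩) = X₀ c := by
    intro c hc
    have : Ωc.orderEmbOfFin rfl ((Ωc.orderIsoOfFin rfl).symm ⟨c, hc⟩) = c := by
      rw [← Finset.coe_orderIsoOfFin_apply, OrderIso.apply_symm_apply]
    ext k
    simp only [rowSub, Matrix.submatrix_apply, id, this]
  have ga := hgap a ha ((Ωc.orderIsoOfFin rfl).symm ⟨a, hsub ha⟩)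
  have gb := hgap a ha ((Ωc.orderIsoOfFin rfl).symm ⟨b, hb⟩)
  rw [key]
  generalize pinv (colSub Φ Ωc) * W = V at *
  rw [aux_rowNorm] at ga gb ⊢
  rw [aux_rowNorm] at ga gb ⊢
  have eb : (rowSub X₀ Ωc + V) ((Ωc.orderIsoOfFin rfl).symm ⟨b, hb⟩)
      = V ((Ωc.orderIsoOfFin rfl).symm ⟨b, hb⟩) := by
    change rowSub X₀ Ωc _ + V _ = _
    rw [hrow, hzero b hbΩ, zero_add]
  have ea : (rowSub X₀ Ωc + V) ((Ωc.orderIsoOfFin rfl).symm ⟨a, hsub ha⟩)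
      = X₀ a + V ((Ωc.orderIsoOfFin rfl).symm ⟨a, hsub ha⟩) := by
    change rowSub X₀ Ωc _ + V _ = _
    rw [hrow]
  rw [ea, eb, WithLp.toLp_add]
  have := norm_sub_le_norm_add (WithLp.toLp 2 (X₀ a) : EuclideanSpace 𝕜 (Fin l))
    (WithLp.toLp 2 (V ((Ωc.orderIsoOfFin rfl).symm ⟨a, hsub ha⟩)))
  linarith

end
end

section
/- Let Φ ∈ K^{m×n}, let X₀ ∈ K^{n×l} have support Ω := supp(X₀), let Ω_c ⊆ {1,…,n} satisfy Ω ⊆ Ω_c, and assume σ_{|Ω_c|}(Φ_{Ω_c}) > 0. Let W ∈ K^{m×l}, Y := Φ X₀ + W, and let κ > 0 satisfy max_{b ∈ Ω_c} ‖(Φ_{Ω_c}^† W)^{{b}}‖₂ < κ ≤ min_{a ∈ Ω} ‖X₀^{{a}}‖₂ − max_{b ∈ Ω_c} ‖(Φ_{Ω_c}^† W)^{{b}}‖₂. Then min_{a ∈ Ω} ‖(Φ_{Ω_c}^† Y)^{{a}}‖₂ ≥ κ > max_{b ∈ Ω_c \ Ω} ‖(Φ_{Ω_c}^† Y)^{{b}}‖₂;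 in particular the set of indices b ∈ Ω_c with ‖(Φ_{Ω_c}^† Y)^{{b}}‖₂ ≥ κ is exactly Ω. -/
open scoped Matrix

noncomputable section

variable {𝕜 : Type*} [RCLike 𝕜]

/-- With a threshold `κ` separating the noise level from the
signal level, the rows of `Φ_{Ω_c}† Y` with ℓ₂ norm at least `κ` are exactly
those indexed by `Ω`. -/
theorem statement2 {m n l : ℕ} (Φ : Matrix (Fin m) (Fin n) 𝕜)
    (X₀ : Matrix (Fin n) (Fin l) 𝕜) (W Y : Matrix (Fin m) (Fin l) 𝕜)
    (Ω Ωc : Finset (Fin n)) (hΩ : rowSupport X₀ = Ω) (hsub : Ω ⊆ Ωc)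
    (hrank : 0 < sval (colSub Φ Ωc) Ωc.card)
    (hY : Y = Φ * X₀ + W) (κ : ℝ) (hκ0 : 0 < κ)
    (hκlow : ∀ b : Fin Ωc.card, rowNorm (pinv (colSub Φ Ωc) * W) b < κ)
    (hκhigh : ∀ a ∈ Ω, ∀ b : Fin Ωc.card,
      κ ≤ rowNorm X₀ a - rowNorm (pinv (colSub Φ Ωc) * W) b) :
    (∀ a, ∀ ha : a ∈ Ω,
        κ ≤ rowNorm (pinv (colSub Φ Ωc) * Y) ((Ωc.orderIsoOfFin rfl).symm ⟨a, hsub ha⟩)) ∧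
    (∀ b, ∀ hb : b ∈ Ωc, b ∉ Ω →
        rowNorm (pinv (colSub Φ Ωc) * Y) ((Ωc.orderIsoOfFin rfl).symm ⟨b, hb⟩) < κ) := by
  have hmem : ∀ i, i ∉ Ω → X₀ i = 0 := by
    intro i hi
    by_contra hne
    exact hi (by rw [← hΩ]; simp [rowSupport, hne])
  have hfac : Φ * X₀ = colSub Φ Ωc * rowSub X₀ Ωc := by
    ext r j
    simp only [Matrix.mul_apply, colSub, rowSub, Matrix.submatrix_apply, id]
    have h1 : ∑ i, Φ r i * X₀ i j = ∑ i ∈ Ωc, Φ r i * X₀ i j := by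
      symm
      apply Finset.sum_subset (Finset.subset_univ _)
      intro i _ hi
      rw [hmem i (fun h => hi (hsub h))]
      simp
    rw [h1, ← Finset.sum_coe_sort Ωc]
    exact (Equiv.sum_comp (Ωc.orderIsoOfFin rfl).toEquiv
      (fun i : Ωc => Φ r i * X₀ i j)).symm
  have hYe : pinv (colSub Φ Ωc) * Y = rowSub X₀ Ωc + pinv (colSub Φ Ωc) * W := by
    rw [hY, Matrix.mul_add, hfac, ← Matrix.mul_assoc, aux_pinv_mul _ hrank, Matrix.one_mul]
  have hrow : ∀ b (hb : b ∈ Ωc),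
      rowSub X₀ Ωc ((Ωc.orderIsoOfFin rfl).symm ⟨b, hb⟩) = X₀ b := by
    intro b hb
    have : Ωc.orderEmbOfFin rfl ((Ωc.orderIsoOfFin rfl).symm ⟨b, hb⟩) = b := by
      rw [← Finset.coe_orderIsoOfFin_apply]
      simp
    funext j
    simp only [rowSub, Matrix.submatrix_apply, id]
    rw [this]
  have hsum : ∀ b (hb : b ∈ Ωc),
      (pinv (colSub Φ Ωc) * Y) ((Ωc.orderIsoOfFin rfl).symm ⟨b, hb⟩) =
        X₀ b + (pinv (colSub Φ Ωc) * W) ((Ωc.orderIsoOfFin rfl).symm ⟨b, hb⟩) := by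
    intro b hb
    rw [hYe, ← hrow b hb]
    rfl
  constructor
  · intro a ha
    have h := hκhigh a ha ((Ωc.orderIsoOfFin rfl).symm ⟨a, hsub ha⟩)
    rw [aux_rowNorm] at h ⊢
    rw [aux_rowNorm] at h
    rw [hsum a (hsub ha), WithLp.toLp_add]
    refine h.trans ?_
    exact norm_sub_le_norm_add _ _
  · intro b hb hbΩ
    have h := hκlow ((Ωc.orderIsoOfFin rfl).symm ⟨b, hb⟩)
    rw [aux_rowNorm] at h ⊢
    rw [hsum b hb, hmem b hbΩ, zero_add]
    exact h

end
end

section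
/- Let A ∈ K^{m×n} with m ≥ n and B ∈ K^{n×g} with g ≥ n. Then for all integers s, i, l with 1 ≤ s ≤ i ≤ n and 1 ≤ l ≤ n − i + 1, one has σ_{i+l−1}(A) · σ_{n−l+1}(B) ≤ σ_i(AB) ≤ σ_{i−s+1}(A) · σ_s(B). -/
open scoped Matrix

noncomputable section

variable {𝕜 : Type*} [RCLike 𝕜]

/-! ### Helper lemmas -/

theorem aux_comap {V W : Type*} [AddCommGroup V] [Module 𝕜 V] [AddCommGroup W] [Module 𝕜 W]
    [FiniteDimensional 𝕜 V] [FiniteDimensional 𝕜 W] (f : V →ₗ[𝕜] W) (U : Submodule 𝕜 V)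
    (P : Submodule 𝕜 W) :
    Module.finrank 𝕜 U + Module.finrank 𝕜 P ≤
      Module.finrank 𝕜 (U ⊓ P.comap f : Submodule 𝕜 V) + Module.finrank 𝕜 W := by
  set h : U →ₗ[𝕜] (W ⧸ P) := P.mkQ ∘ₗ f ∘ₗ U.subtype with hh
  have h1 := LinearMap.finrank_range_add_finrank_ker h
  have h2 : Module.finrank 𝕜 (LinearMap.range h) ≤ Module.finrank 𝕜 (W ⧸ P) :=
    Submodule.finrank_le _
  have h3 := Submodule.finrank_quotient_add_finrank P
  have h4 : (LinearMap.ker h).map U.subtype ≤ U ⊓ P.comap f := by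
    rintro _ ⟨x, hx, rfl⟩
    refine ⟨x.2, ?_⟩
    have hx' : h x = 0 := hx
    rw [hh] at hx'
    simpa using hx'
  have h5 := Submodule.finrank_mono h4
  rw [Submodule.finrank_map_subtype_eq] at h5
  omega

theorem aux_sub {V : Type*} [AddCommGroup V] [Module 𝕜 V]
    [FiniteDimensional 𝕜 V] (U : Submodule 𝕜 V) (k : ℕ) (hk : k ≤ Module.finrank 𝕜 U) :
    ∃ S ≤ U, Module.finrank 𝕜 S = k := by
  let b := Module.finBasis 𝕜 U
  let v : Fin k → V := fun j => (b (Fin.castLE hk j) : V)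
  have hv : LinearIndependent 𝕜 v := by
    have h1 := b.linearIndependent.map' U.subtype U.ker_subtype
    exact h1.comp (Fin.castLE hk) (Fin.castLE_injective hk)
  refine ⟨Submodule.span 𝕜 (Set.range v), ?_, ?_⟩
  · rw [Submodule.span_le]
    rintro _ ⟨j, rfl⟩
    exact (b (Fin.castLE hk j)).2
  · simpa using finrank_span_eq_card hv

theorem aux_span {n : ℕ} {E : Type*} [NormedAddCommGroup E] [InnerProductSpace 𝕜 E]
    (b : OrthonormalBasis (Fin n) 𝕜 E) (p : Finset (Fin n)) :
    ∃ S : Submodule 𝕜 E, Module.finrank 𝕜 S = p.card ∧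
      ∀ x ∈ S, ∀ k ∉ p, inner 𝕜 (b k) x = 0 := by
  refine ⟨Submodule.span 𝕜 (Set.range fun k : p => b k), ?_, ?_⟩
  · have : LinearIndependent 𝕜 (fun k : p => b k) :=
      b.orthonormal.linearIndependent.comp _ Subtype.val_injective
    simpa using finrank_span_eq_card this
  · intro x hx k hk
    induction hx using Submodule.span_induction with
    | mem x hx =>
      obtain ⟨j, rfl⟩ := hx
      apply b.orthonormal.2
      rintro rfl
      exact hk j.2
    | zero => simp
    | add x y _ _ hx hy => simp [inner_add_right, hx, hy]
    | smul c x _ hx => simp [inner_smul_right, hx]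

theorem aux_spec {n : ℕ} {E F : Type*} [NormedAddCommGroup E] [InnerProductSpace 𝕜 E]
    [NormedAddCommGroup F] [InnerProductSpace 𝕜 F] [FiniteDimensional 𝕜 E]
    [FiniteDimensional 𝕜 F] (hn : Module.finrank 𝕜 E = n) (T : E →ₗ[𝕜] F) :
    ∃ (b : OrthonormalBasis (Fin n) 𝕜 E) (lam : Fin n → ℝ), Antitone lam ∧ (∀ k, 0 ≤ lam k) ∧
      ∀ x, ‖T x‖ ^ 2 = ∑ k, lam k * ‖inner 𝕜 (b k) x‖ ^ 2 := by
  have hT := T.isSymmetric_adjoint_comp_self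
  refine ⟨hT.eigenvectorBasis hn, hT.eigenvalues hn, hT.eigenvalues_antitone hn,
    fun k => T.isPositive_adjoint_comp_self.nonneg_eigenvalues hn k, fun x => ?_⟩
  set b := hT.eigenvectorBasis hn
  have h1 : ((‖T x‖ ^ 2 : ℝ) : 𝕜) = inner 𝕜 x ((LinearMap.adjoint T ∘ₗ T) x) := by
    rw [LinearMap.comp_apply, LinearMap.adjoint_inner_right, inner_self_eq_norm_sq_to_K]
    push_cast; rfl
  have h2 : ∀ k, inner 𝕜 (b k) ((LinearMap.adjoint T ∘ₗ T) x)
      = (hT.eigenvalues hn k : 𝕜) * inner 𝕜 (b k) x := by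
    intro k
    rw [← hT (b k) x, hT.apply_eigenvectorBasis hn k, inner_smul_left]
    simp [b]
  have h3 : ((‖T x‖ ^ 2 : ℝ) : 𝕜) =
      ((∑ k, hT.eigenvalues hn k * ‖inner 𝕜 (b k) x‖ ^ 2 : ℝ) : 𝕜) := by
    rw [h1, ← b.sum_inner_mul_inner]
    simp only [h2]
    push_cast
    refine Finset.sum_congr rfl fun k _ => ?_
    rw [← inner_conj_symm x (b k), mul_left_comm, RCLike.conj_mul]
  exact_mod_cast h3

theorem sval_bdd {m n : ℕ} (A : Matrix (Fin m) (Fin n) 𝕜) (i : ℕ) (hi : 1 ≤ i) :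
    BddAbove { t : ℝ | 0 ≤ t ∧ ∃ S : Submodule 𝕜 (EuclideanSpace 𝕜 (Fin n)),
    Module.finrank 𝕜 S = i ∧ ∀ x ∈ S, t * ‖x‖ ≤ ‖Matrix.toEuclideanLin A x‖ } := by
  refine ⟨‖(Matrix.toEuclideanLin A).toContinuousLinearMap‖, ?_⟩
  rintro t ⟨-, S, hS, h⟩
  obtain ⟨x, hx, hx0⟩ := S.exists_mem_ne_zero_of_ne_bot (by
    rintro rfl
    simp at hS
    omega)
  have h1 := h x hx
  have h2 := (Matrix.toEuclideanLin A).toContinuousLinearMap.le_opNorm x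
  exact le_of_mul_le_mul_right (h1.trans h2) (norm_pos_iff.2 hx0)

theorem sval_nonneg {m n : ℕ} (A : Matrix (Fin m) (Fin n) 𝕜) (i : ℕ) : 0 ≤ sval A i :=
  Real.sSup_nonneg fun _ h => h.1

/-- Both halves of Courant–Fischer. -/
theorem sval_spec {m n : ℕ} (A : Matrix (Fin m) (Fin n) 𝕜) (i : ℕ) (hi : 1 ≤ i) (hin : i ≤ n) :
    (∃ S : Submodule 𝕜 (EuclideanSpace 𝕜 (Fin n)),
      Module.finrank 𝕜 S = i ∧ ∀ x ∈ S, sval A i * ‖x‖ ≤ ‖Matrix.toEuclideanLin A x‖) ∧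
    (∃ S : Submodule 𝕜 (EuclideanSpace 𝕜 (Fin n)),
      Module.finrank 𝕜 S + i = n + 1 ∧
        ∀ x ∈ S, ‖Matrix.toEuclideanLin A x‖ ≤ sval A i * ‖x‖) := by
  obtain ⟨b, lam, hanti, hpos, hsum⟩ := aux_spec (n := n) (by simp) (Matrix.toEuclideanLin A)
  let k0 : Fin n := ⟨i - 1, by omega⟩
  obtain ⟨S, hS, hS0⟩ := aux_span b (Finset.Iic k0)
  obtain ⟨R, hR, hR0⟩ := aux_span b (Finset.Ici k0)
  rw [Fin.card_Iic] at hS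
  rw [Fin.card_Ici] at hR
  have hk0 : (k0 : ℕ) = i - 1 := rfl
  have hS' : Module.finrank 𝕜 S = i := by omega
  have hR' : Module.finrank 𝕜 R + i = n + 1 := by omega
  set r := Real.sqrt (lam k0) with hr
  have hr2 : r ^ 2 = lam k0 := Real.sq_sqrt (hpos k0)
  have hr0 : 0 ≤ r := Real.sqrt_nonneg _
  have hlow : ∀ x ∈ S, r * ‖x‖ ≤ ‖Matrix.toEuclideanLin A x‖ := by
    intro x hx
    apply le_of_sq_le_sq _ (norm_nonneg _)
    rw [mul_pow, hr2, hsum, ← b.sum_sq_norm_inner_right x, Finset.mul_sum]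
    refine Finset.sum_le_sum fun k _ => ?_
    by_cases hk : k ∈ Finset.Iic k0
    · exact mul_le_mul_of_nonneg_right (hanti (Finset.mem_Iic.1 hk)) (by positivity)
    · simp [hS0 x hx k hk]
  have hup : ∀ x ∈ R, ‖Matrix.toEuclideanLin A x‖ ≤ r * ‖x‖ := by
    intro x hx
    apply le_of_sq_le_sq _ (by positivity)
    rw [mul_pow, hr2, hsum, ← b.sum_sq_norm_inner_right x, Finset.mul_sum]
    refine Finset.sum_le_sum fun k _ => ?_
    by_cases hk : k ∈ Finset.Ici k0
    · exact mul_le_mul_of_nonneg_right (hanti (Finset.mem_Ici.1 hk)) (by positivity)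
    · simp [hR0 x hx k hk]
  have heq : sval A i = r := by
    apply le_antisymm
    · apply Real.sSup_le _ hr0
      rintro t ⟨-, Q, hQ, h⟩
      have h1 := aux_comap (LinearMap.id) Q R
      obtain ⟨x, hx, hx0⟩ := (Q ⊓ R.comap LinearMap.id).exists_mem_ne_zero_of_ne_bot (by
        intro h0
        rw [h0] at h1
        simp at h1
        omega)
      exact le_of_mul_le_mul_right ((h x hx.1).trans (hup x hx.2)) (norm_pos_iff.2 hx0)
    · exact le_csSup (sval_bdd A i hi) ⟨hr0, S, hS', hlow⟩
  rw [heq]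
  exact ⟨⟨S, hS', hlow⟩, ⟨R, hR', hup⟩⟩

/-- Singular-value inequalities for a matrix product
(generalization of Merikoski–Kumar). -/
theorem statement6 {m n g : ℕ} (A : Matrix (Fin m) (Fin n) 𝕜)
    (B : Matrix (Fin n) (Fin g) 𝕜) (hmn : n ≤ m) (hg : n ≤ g)
    (s i l : ℕ) (hs : 1 ≤ s) (hsi : s ≤ i) (hin : i ≤ n)
    (hl : 1 ≤ l) (hln : l ≤ n - i + 1) :
    sval A (i + l - 1) * sval B (n - l + 1) ≤ sval (A * B) i ∧
      sval (A * B) i ≤ sval A (i - s + 1) * sval B s := by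
  have hAB : ∀ x, Matrix.toEuclideanLin (A * B) x
      = Matrix.toEuclideanLin A (Matrix.toEuclideanLin B x) := by
    intro x
    simp [Matrix.toEuclideanLin, Matrix.toLpLin_apply, Matrix.mulVec_mulVec]
  constructor
  · obtain ⟨⟨SA, hSA, hA⟩, -⟩ := sval_spec A (i + l - 1) (by omega) (by omega)
    obtain ⟨⟨SB, hSB, hB⟩, -⟩ := sval_spec B (n - l + 1) (by omega) (by omega)
    have h1 := aux_comap (Matrix.toEuclideanLin B) SB SA
    simp only [finrank_euclideanSpace, Fintype.card_fin] at h1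
    obtain ⟨S, hS, hSi⟩ := aux_sub (SB ⊓ SA.comap (Matrix.toEuclideanLin B)) i (by omega)
    refine le_csSup (sval_bdd (A * B) i (by omega))
      ⟨mul_nonneg (sval_nonneg _ _) (sval_nonneg _ _), S, hSi, fun x hx => ?_⟩
    rw [hAB, mul_assoc]
    exact (mul_le_mul_of_nonneg_left (hB x (hS hx).1) (sval_nonneg _ _)).trans
      (hA _ (hS hx).2)
  · obtain ⟨-, SA, hSA, hA⟩ := sval_spec A (i - s + 1) (by omega) (by omega)
    obtain ⟨-, SB, hSB, hB⟩ := sval_spec B s (by omega) (by omega)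
    refine Real.sSup_le ?_ (mul_nonneg (sval_nonneg _ _) (sval_nonneg _ _))
    rintro t ⟨-, Q, hQ, h⟩
    have h1 := aux_comap LinearMap.id Q SB
    have h2 := aux_comap (Matrix.toEuclideanLin B) (Q ⊓ SB.comap LinearMap.id) SA
    simp only [finrank_euclideanSpace, Fintype.card_fin] at h1 h2
    obtain ⟨x, hx, hx0⟩ := ((Q ⊓ SB.comap LinearMap.id) ⊓
      SA.comap (Matrix.toEuclideanLin B)).exists_mem_ne_zero_of_ne_bot (by
        intro h0
        rw [h0, finrank_bot] at h2
        omega)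
    have h3 := h x hx.1.1
    rw [hAB] at h3
    refine le_of_mul_le_mul_right (h3.trans ?_) (norm_pos_iff.2 hx0)
    rw [mul_assoc]
    exact (hA _ hx.2).trans (mul_le_mul_of_nonneg_left (hB x hx.1.2) (sval_nonneg _ _))
end
end

section
/- Let A = [a₁,…,a_n] ∈ K^{m×n} be a matrix whose columns are ℓ₂-normalized, and let J, Q ⊆ {1,…,n} be disjoint subsets with σ_{|Q|}(A_Q) > 0. If max_{i ∈ Q} Σ_{j ∈ Q, j ≠ i} |⟨a_i, a_j⟩| < 1, then max_{i ∈ J} ‖A_Q^† a_i‖₁ ≤ ( max_{i ∈ J} Σ_{j ∈ Q} |⟨a_i, a_j⟩| ) / ( 1 − max_{i ∈ Q} Σ_{j ∈ Q, j ≠ i} |⟨a_i, a_j⟩| ). -/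
open scoped Matrix

noncomputable section

variable {𝕜 : Type*} [RCLike 𝕜]

theorem coh_symm {m n : ℕ} (A : Matrix (Fin m) (Fin n) 𝕜) (i j : Fin n) :
    ‖∑ r, star (A r i) * A r j‖ = ‖∑ r, star (A r j) * A r i‖ := by
  rw [← norm_star, star_sum]
  simp [mul_comm]

theorem sum_Q {n : ℕ} (Q : Finset (Fin n)) (f : Fin n → ℝ) :
    ∑ q : Fin Q.card, f (Q.orderEmbOfFin rfl q) = ∑ j ∈ Q, f j := by
  rw [← Finset.sum_coe_sort Q f]
  exact Fintype.sum_equiv (Q.orderIsoOfFin rfl).toEquiv _ _ (fun q => rfl)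

theorem gram_bound {N : ℕ} (G : Matrix (Fin N) (Fin N) 𝕜) (x y : Fin N → 𝕜) (μ : ℝ)
    (hd : ∀ k, G k k = 1)
    (hμ : ∀ l, ∑ k ∈ Finset.univ.erase l, ‖G k l‖ ≤ μ) (h : G.mulVec x = y) :
    (1 - μ) * ∑ k, ‖x k‖ ≤ ∑ k, ‖y k‖ := by
  have h1 : ∀ k, ‖x k‖ + ‖x k‖ ≤ ‖y k‖ + ∑ l, ‖G k l‖ * ‖x l‖ := by
    intro k
    have e : y k = G k k * x k + ∑ l ∈ Finset.univ.erase k, G k l * x l := by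
      rw [← h, Finset.add_sum_erase _ (fun l => G k l * x l) (Finset.mem_univ k)]
      rfl
    have e2 : x k = y k - ∑ l ∈ Finset.univ.erase k, G k l * x l := by
      rw [e, hd]; ring
    have e3 : ‖x k‖ ≤ ‖y k‖ + ∑ l ∈ Finset.univ.erase k, ‖G k l‖ * ‖x l‖ := by
      calc ‖x k‖ = ‖y k - ∑ l ∈ Finset.univ.erase k, G k l * x l‖ := by rw [← e2]
        _ ≤ ‖y k‖ + ‖∑ l ∈ Finset.univ.erase k, G k l * x l‖ := norm_sub_le _ _
        _ ≤ _ := by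
          gcongr
          refine (norm_sum_le _ _).trans (le_of_eq ?_)
          simp
    have e4 := Finset.add_sum_erase Finset.univ (fun l => ‖G k l‖ * ‖x l‖) (Finset.mem_univ k)
    simp only [hd, norm_one, one_mul] at e4
    linarith
  have h2 := Finset.sum_le_sum (fun k (_ : k ∈ Finset.univ) => h1 k)
  rw [Finset.sum_add_distrib, Finset.sum_add_distrib, Finset.sum_comm] at h2
  have h3 : ∑ l, ∑ k, ‖G k l‖ * ‖x l‖ ≤ ∑ l, (1 + μ) * ‖x l‖ := by
    refine Finset.sum_le_sum (fun l _ => ?_)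
    rw [← Finset.sum_mul]
    refine mul_le_mul_of_nonneg_right ?_ (norm_nonneg _)
    have e4 := Finset.add_sum_erase Finset.univ (fun k => ‖G k l‖) (Finset.mem_univ l)
    simp only [hd, norm_one] at e4
    linarith [hμ l]
  rw [← Finset.mul_sum] at h3
  linarith

theorem bdd_aux {n : ℕ} (S : Finset (Fin n)) (f : Fin n → ℝ) :
    BddAbove {t : ℝ | ∃ i ∈ S, t = f i} := by
  refine ((S.finite_toSet.image f).subset ?_).bddAbove
  rintro t ⟨i, hi, rfl⟩
  exact ⟨i, hi, rfl⟩

/-- Bound on the ℓ₁ norms `‖A_Q† a_i‖₁`, `i ∈ J`, in terms of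
cumulative coherences (Tropp's exact-recovery-type bound). -/
theorem statement7 {m n : ℕ} (A : Matrix (Fin m) (Fin n) 𝕜)
    (hnorm : ∀ i : Fin n, ∑ r, ‖A r i‖ ^ 2 = 1)
    (J Q : Finset (Fin n)) (hdisj : Disjoint J Q)
    (hsv : 0 < sval (colSub A Q) Q.card)
    (hcoh : sSup {t : ℝ | ∃ i ∈ Q,
        t = ∑ j ∈ Q.erase i, ‖∑ r, star (A r i) * A r j‖} < 1) :
    sSup {t : ℝ | ∃ i ∈ J,
        t = ∑ q, ‖(pinv (colSub A Q)).mulVec (fun r => A r i) q‖} ≤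
      (sSup {t : ℝ | ∃ i ∈ J, t = ∑ j ∈ Q, ‖∑ r, star (A r i) * A r j‖}) /
        (1 - sSup {t : ℝ | ∃ i ∈ Q,
          t = ∑ j ∈ Q.erase i, ‖∑ r, star (A r i) * A r j‖}) := by
  set μ := sSup {t : ℝ | ∃ i ∈ Q,
          t = ∑ j ∈ Q.erase i, ‖∑ r, star (A r i) * A r j‖} with hμdef
  set M := sSup {t : ℝ | ∃ i ∈ J, t = ∑ j ∈ Q, ‖∑ r, star (A r i) * A r j‖} with hM
  have hμ0 : 0 < 1 - μ := by linarith
  have hM0 : 0 ≤ M := by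
    refine Real.sSup_nonneg ?_
    rintro t ⟨i, hi, rfl⟩
    positivity
  refine Real.sSup_le ?_ (div_nonneg hM0 hμ0.le)
  rintro t ⟨i, hi, rfl⟩
  set B := colSub A Q with hB
  by_cases hdet : IsUnit (Bᴴ * B).det
  · rw [le_div_iff₀ hμ0, mul_comm]
    have hG : ∀ k l, (Bᴴ * B) k l = ∑ r, star (A r (Q.orderEmbOfFin rfl k)) *
        A r (Q.orderEmbOfFin rfl l) := by
      intro k l
      simp [Matrix.mul_apply, hB, colSub]
    have key := gram_bound (Bᴴ * B) ((pinv B).mulVec (fun r => A r i))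
      (Bᴴ.mulVec (fun r => A r i)) μ ?_ ?_ ?_
    · refine key.trans ?_
      have e : ∑ k, ‖Bᴴ.mulVec (fun r => A r i) k‖ =
          ∑ j ∈ Q, ‖∑ r, star (A r i) * A r j‖ := by
        rw [← sum_Q Q (fun j => ‖∑ r, star (A r i) * A r j‖)]
        refine Finset.sum_congr rfl (fun k _ => ?_)
        rw [coh_symm]
        rfl
      rw [e]
      exact le_csSup (bdd_aux J (fun i => ∑ j ∈ Q, ‖∑ r, star (A r i) * A r j‖)) ⟨i, hi, rfl⟩
    · intro k
      rw [hG]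
      have := hnorm (Q.orderEmbOfFin rfl k)
      have h2 : ∀ z : 𝕜, star z * z = ((‖z‖ ^ 2 : ℝ) : 𝕜) := by
        intro z
        simpa using RCLike.conj_mul z
      simp only [h2]
      rw [← RCLike.ofReal_sum, this, RCLike.ofReal_one]
    · intro l
      have hl : Q.orderEmbOfFin rfl l ∈ Q := Finset.orderEmbOfFin_mem Q rfl l
      refine le_trans (le_of_eq ?_) (le_csSup
        (bdd_aux Q (fun i => ∑ j ∈ Q.erase i, ‖∑ r, star (A r i) * A r j‖)) ⟨_, hl, rfl⟩)
      have e1 := Finset.add_sum_erase Q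
        (fun j => ‖∑ r, star (A r (Q.orderEmbOfFin rfl l)) * A r j‖) hl
      have e2 := Finset.add_sum_erase Finset.univ (fun k => ‖(Bᴴ * B) k l‖) (Finset.mem_univ l)
      have e3 : ∑ k, ‖(Bᴴ * B) k l‖ =
          ∑ j ∈ Q, ‖∑ r, star (A r (Q.orderEmbOfFin rfl l)) * A r j‖ := by
        rw [← sum_Q Q (fun j => ‖∑ r, star (A r (Q.orderEmbOfFin rfl l)) * A r j‖)]
        refine Finset.sum_congr rfl (fun k _ => ?_)
        rw [hG, coh_symm]
      have e4 := congrArg norm (hG l l)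
      linarith
    · rw [Matrix.mulVec_mulVec, pinv, ← Matrix.mul_assoc, Matrix.mul_nonsing_inv _ hdet,
        Matrix.one_mul]
  · have : pinv B = 0 := by
      rw [pinv, Matrix.nonsing_inv_apply_not_isUnit _ hdet, Matrix.zero_mul]
    rw [this]
    simpa using div_nonneg hM0 hμ0.le

end
end

section
/- Let Φ = [φ₁,…,φ_n] ∈ K^{m×n}, let Ω, Γ ⊆ {1,…,n}, and let S̄ be a subspace of R(Φ_Ω) (more precisely, an r-dimensional subspace of R(Φ_Ω X₀^Ω) for a row k-sparse X₀ with support Ω). Assume P^⊥_{R(Φ_Γ)} φ_l ≠ 0 for every l ∈ Ω \ Γ, and set d := dim(P^⊥_{R(Φ_Γ)} S̄) ≥ 1. Then max_{l ∈ Ω \ Γ} ‖P_{P^⊥_{R(Φ_Γ)} S̄} φ̇_l‖₂ ≥ √(d / |Ω \ Γ|) · σ_{|Ω \ Γ|}(Φ̇_{Ω \ Γ}). -/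
open scoped Matrix

noncomputable section

variable {𝕜 : Type*} [RCLike 𝕜]

theorem toEuc_eq_sum {m N : ℕ} (A : Matrix (Fin m) (Fin N) 𝕜) (x : EuclideanSpace 𝕜 (Fin N)) :
    Matrix.toEuclideanLin A x = ∑ j, x j • col A j := by
  ext i
  simp [col, Matrix.toLpLin_apply, Matrix.mulVec, dotProduct, mul_comm]

theorem col_mem_mrange {m N : ℕ} (A : Matrix (Fin m) (Fin N) 𝕜) (j : Fin N) :
    col A j ∈ mrange A := by
  refine ⟨EuclideanSpace.single j 1, ?_⟩
  rw [toEuc_eq_sum]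
  simp

theorem mrange_le_iff {m N : ℕ} (A : Matrix (Fin m) (Fin N) 𝕜)
    (W : Submodule 𝕜 (EuclideanSpace 𝕜 (Fin m))) (h : ∀ j, col A j ∈ W) : mrange A ≤ W := by
  rintro _ ⟨x, rfl⟩
  rw [toEuc_eq_sum]
  exact W.sum_mem fun j _ => W.smul_mem _ (h j)

theorem mrange_mul_le {m N p : ℕ} (A : Matrix (Fin m) (Fin N) 𝕜) (B : Matrix (Fin N) (Fin p) 𝕜) :
    mrange (A * B) ≤ mrange A := by
  rintro _ ⟨x, rfl⟩
  refine ⟨Matrix.toEuclideanLin B x, ?_⟩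
  ext i
  simp [Matrix.toLpLin_apply, Matrix.mulVec_mulVec]

theorem exists_emb {n : ℕ} (J : Finset (Fin n)) {i : Fin n} (hi : i ∈ J) :
    ∃ j : Fin J.card, J.orderEmbOfFin rfl j = i := by
  have h := Finset.range_orderEmbOfFin J rfl
  have : i ∈ Set.range (J.orderEmbOfFin rfl) := by rw [h]; exact hi
  exact this

theorem range_bound {m N : ℕ} (A : Matrix (Fin m) (Fin N) 𝕜) (t : ℝ) (ht : 0 ≤ t)
    (hA : ∀ x, t * ‖x‖ ≤ ‖Matrix.toEuclideanLin A x‖) (e : EuclideanSpace 𝕜 (Fin m))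
    (he : e ∈ mrange A) (he1 : ‖e‖ = 1) :
    t ^ 2 ≤ ∑ j, ‖inner 𝕜 e (col A j)‖ ^ 2 := by
  obtain ⟨x, rfl⟩ := he
  have hx := hA x
  set e := Matrix.toEuclideanLin A x with hedef
  have h1 : (1 : ℝ) ≤ ∑ j, ‖x j‖ * ‖inner 𝕜 e (col A j)‖ := by
    have : inner 𝕜 e e = ∑ j, x j * inner 𝕜 e (col A j) := by
      conv_lhs => rw [hedef]
      conv_lhs => arg 3; rw [toEuc_eq_sum]
      rw [inner_sum]
      simp only [inner_smul_right]
      rfl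
    have h2 : ‖(inner 𝕜 e e : 𝕜)‖ = 1 := by
      rw [inner_self_eq_norm_sq_to_K, he1]; simp
    rw [← h2, this]
    refine (norm_sum_le _ _).trans (le_of_eq ?_)
    simp
  have h3 := Finset.sum_mul_sq_le_sq_mul_sq Finset.univ (fun j => ‖x j‖)
    (fun j => ‖inner 𝕜 e (col A j)‖)
  rw [← EuclideanSpace.norm_sq_eq x] at h3
  set s := ∑ j, ‖inner 𝕜 e (col A j)‖ ^ 2
  have hs : 0 ≤ s := Finset.sum_nonneg fun _ _ => by positivity
  have h4 : 1 ≤ ‖x‖ ^ 2 * s := by nlinarith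
  rw [he1] at hx
  have h5 : (t * ‖x‖) ^ 2 ≤ 1 := pow_le_one₀ (by positivity) hx
  calc t ^ 2 = t ^ 2 * 1 := by ring
    _ ≤ t ^ 2 * (‖x‖ ^ 2 * s) := by gcongr
    _ = (t * ‖x‖) ^ 2 * s := by ring
    _ ≤ 1 * s := by gcongr
    _ = s := one_mul s

theorem norm_proj_sq {m : ℕ} (T : Submodule 𝕜 (EuclideanSpace 𝕜 (Fin m)))
    (v : EuclideanSpace 𝕜 (Fin m)) :
    ‖proj T v‖ ^ 2 = ∑ i, ‖inner 𝕜 ((stdOrthonormalBasis 𝕜 T i : T) : EuclideanSpace 𝕜 (Fin m)) v‖ ^ 2 := by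
  have h : ‖proj T v‖ = ‖Submodule.orthogonalProjectionOnto T v‖ := rfl
  rw [h, ← (stdOrthonormalBasis 𝕜 T).sum_sq_norm_inner_right]
  refine Finset.sum_congr rfl fun i _ => ?_
  rw [Submodule.inner_orthogonalProjectionOnto_eq_of_mem_left]

theorem sum_bound {m N : ℕ} (A : Matrix (Fin m) (Fin N) 𝕜) (t : ℝ) (ht : 0 ≤ t)
    (hA : ∀ x, t * ‖x‖ ≤ ‖Matrix.toEuclideanLin A x‖)
    (T : Submodule 𝕜 (EuclideanSpace 𝕜 (Fin m))) (hT : T ≤ mrange A) :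
    (Module.finrank 𝕜 T : ℝ) * t ^ 2 ≤ ∑ j, ‖proj T (col A j)‖ ^ 2 := by
  simp only [norm_proj_sq]
  rw [Finset.sum_comm]
  calc (Module.finrank 𝕜 T : ℝ) * t ^ 2 = ∑ _i : Fin (Module.finrank 𝕜 T), t ^ 2 := by simp
    _ ≤ _ := Finset.sum_le_sum fun i _ => range_bound A t ht hA _ (hT (stdOrthonormalBasis 𝕜 T i).2) (by
        have := (stdOrthonormalBasis 𝕜 T).norm_eq_one i
        exact this)

theorem map_le {m n : ℕ} (Φ : Matrix (Fin m) (Fin n) 𝕜) (Ω Γ : Finset (Fin n)) :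
    mrange (colSub Φ Ω) ≤ (mrange (ndotMat Φ Γ (Ω \ Γ))).comap
      (proj (mrange (colSub Φ Γ))ᗮ :
        EuclideanSpace 𝕜 (Fin m) →ₗ[𝕜] EuclideanSpace 𝕜 (Fin m)) := by
  apply mrange_le_iff
  intro j
  have hi : Ω.orderEmbOfFin rfl j ∈ Ω := Finset.orderEmbOfFin_mem _ _ _
  have hc : col (colSub Φ Ω) j = col Φ (Ω.orderEmbOfFin rfl j) := rfl
  rw [hc]
  generalize Ω.orderEmbOfFin rfl j = i at hi
  rw [Submodule.mem_comap]
  change proj (mrange (colSub Φ Γ))ᗮ (col Φ i) ∈ _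
  by_cases h0 : proj (mrange (colSub Φ Γ))ᗮ (col Φ i) = 0
  · rw [h0]; exact Submodule.zero_mem _
  have hiΓ : i ∉ Γ := by
    intro hΓ
    apply h0
    obtain ⟨j', hj'⟩ := exists_emb Γ hΓ
    have hm : col Φ i ∈ mrange (colSub Φ Γ) := by
      rw [← hj']
      exact col_mem_mrange (colSub Φ Γ) j'
    have : Submodule.orthogonalProjectionOnto (mrange (colSub Φ Γ))ᗮ (col Φ i) = 0 := by
      rw [Submodule.orthogonalProjectionOnto_eq_zero_iff]
      exact Submodule.le_orthogonal_orthogonal _ hm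
    simp [proj, this]
  obtain ⟨j', hj'⟩ := exists_emb (Ω \ Γ) (Finset.mem_sdiff.2 ⟨hi, hiΓ⟩)
  have hm : ndot Φ Γ i ∈ mrange (ndotMat Φ Γ (Ω \ Γ)) := by
    rw [← hj']
    exact col_mem_mrange (ndotMat Φ Γ (Ω \ Γ)) j'
  have hn : ‖proj (mrange (colSub Φ Γ))ᗮ (col Φ i)‖ ≠ 0 := norm_ne_zero_iff.2 h0
  have : proj (mrange (colSub Φ Γ))ᗮ (col Φ i) =
      ((‖proj (mrange (colSub Φ Γ))ᗮ (col Φ i)‖ : ℝ) : 𝕜) • ndot Φ Γ i := by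
    rw [ndot, ← RCLike.real_smul_eq_coe_smul, smul_smul, mul_inv_cancel₀ hn, one_smul]
  rw [this]
  exact Submodule.smul_mem _ _ hm

/-- Lower bound on the largest norm of the projections of the
normalized columns `φ̇_l`, `l ∈ Ω \ Γ`, onto the projected signal subspace. -/
theorem statement9 {m n l k r : ℕ} (Φ : Matrix (Fin m) (Fin n) 𝕜)
    (X₀ : Matrix (Fin n) (Fin l) 𝕜) (Ω Γ : Finset (Fin n))
    (hΩ : rowSupport X₀ = Ω) (hk : Ω.card ≤ k)
    (Sbar : Submodule 𝕜 (EuclideanSpace 𝕜 (Fin m)))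
    (hS : Sbar ≤ mrange (colSub Φ Ω * rowSub X₀ Ω))
    (hr : Module.finrank 𝕜 Sbar = r)
    (hnz : ∀ i ∈ Ω \ Γ, proj (mrange (colSub Φ Γ))ᗮ (col Φ i) ≠ 0)
    (d : ℕ) (hd : d = Module.finrank 𝕜 (Sbar.map (proj (mrange (colSub Φ Γ))ᗮ :
      EuclideanSpace 𝕜 (Fin m) →ₗ[𝕜] EuclideanSpace 𝕜 (Fin m))))
    (hd1 : 1 ≤ d) :
    ∃ l₀ ∈ Ω \ Γ,
      Real.sqrt ((d : ℝ) / (Ω \ Γ).card) * sval (ndotMat Φ Γ (Ω \ Γ)) (Ω \ Γ).card ≤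
        ‖proj (Sbar.map (proj (mrange (colSub Φ Γ))ᗮ :
          EuclideanSpace 𝕜 (Fin m) →ₗ[𝕜] EuclideanSpace 𝕜 (Fin m))) (ndot Φ Γ l₀)‖ := by
  have hT : Sbar.map (proj (mrange (colSub Φ Γ))ᗮ :
      EuclideanSpace 𝕜 (Fin m) →ₗ[𝕜] EuclideanSpace 𝕜 (Fin m)) ≤
      mrange (ndotMat Φ Γ (Ω \ Γ)) :=
    Submodule.map_le_iff_le_comap.2 ((hS.trans (mrange_mul_le _ _)).trans (map_le Φ Ω Γ))
  generalize Sbar.map (proj (mrange (colSub Φ Γ))ᗮ :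
      EuclideanSpace 𝕜 (Fin m) →ₗ[𝕜] EuclideanSpace 𝕜 (Fin m)) = T at hT hd ⊢
  have hcard : 1 ≤ (Ω \ Γ).card := by
    have h1 := Submodule.finrank_mono hT
    have h2 := LinearMap.finrank_range_le (Matrix.toEuclideanLin (ndotMat Φ Γ (Ω \ Γ)))
    rw [finrank_euclideanSpace_fin] at h2
    unfold mrange at h1
    omega
  obtain ⟨l₀, hl₀, hmax⟩ := Finset.exists_max_image (Ω \ Γ)
    (fun i => ‖proj T (ndot Φ Γ i)‖) (Finset.card_pos.1 hcard)
  refine ⟨l₀, hl₀, ?_⟩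
  have hdpos : (0 : ℝ) < d := by exact_mod_cast hd1
  have hNpos : (0 : ℝ) < (Ω \ Γ).card := by exact_mod_cast hcard
  have hq : 0 < Real.sqrt ((d : ℝ) / (Ω \ Γ).card) := Real.sqrt_pos.2 (div_pos hdpos hNpos)
  rw [mul_comm, ← le_div_iff₀ hq]
  refine Real.sSup_le ?_ (by positivity)
  rintro t ⟨ht, S, hSd, hSt⟩
  have hStop : S = ⊤ := Submodule.eq_top_of_finrank_eq (by rw [hSd, finrank_euclideanSpace_fin])
  subst hStop
  have hb := sum_bound (ndotMat Φ Γ (Ω \ Γ)) t ht (fun x => hSt x trivial) T hT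
  rw [← hd] at hb
  have hle : ∑ j, ‖proj T (col (ndotMat Φ Γ (Ω \ Γ)) j)‖ ^ 2 ≤
      ∑ _j : Fin (Ω \ Γ).card, ‖proj T (ndot Φ Γ l₀)‖ ^ 2 := by
    refine Finset.sum_le_sum fun j _ => ?_
    have := hmax _ (Finset.orderEmbOfFin_mem (Ω \ Γ) rfl j)
    exact pow_le_pow_left₀ (norm_nonneg _) this 2
  have h3 := hb.trans hle
  simp only [Finset.sum_const, Finset.card_univ, Fintype.card_fin, nsmul_eq_mul] at h3
  rw [le_div_iff₀ hq]
  refine le_of_sq_le_sq ?_ (norm_nonneg _)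
  rw [mul_pow, Real.sq_sqrt (by positivity), ← mul_div_assoc, div_le_iff₀ hNpos]
  linarith

end
end

section
/- Let X₀ ∈ K^{n×l} be row k-sparse with support Ω, let Γ be a proper subset of {1,…,n}, let S̄ be an r-dimensional subspace of R(Φ_Ω X₀^Ω), and suppose σ_{|Ω ∪ Γ|}(Φ_{Ω ∪ Γ}) > 0. Then max_{i ∈ {1,…,n} \ (Ω ∪ Γ)} ‖P_{R(P^⊥_{R(Φ_Γ)} S̄)} φ̇_i‖₂ ≤ ( max_{i ∈ {1,…,n} \ (Ω ∪ Γ)} ‖Φ̇_{Ω \ Γ}^† φ̇_i‖₁ ) · ( max_{l ∈ Ω \ Γ} ‖P_{R(P^⊥_{R(Φ_Γ)} S̄)} φ̇_l‖₂ ). -/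
open scoped Matrix

noncomputable section

variable {𝕜 : Type*} [RCLike 𝕜]

theorem aux_toEuclideanLin {m p : ℕ} (A : Matrix (Fin m) (Fin p) 𝕜)
    (x : EuclideanSpace 𝕜 (Fin p)) :
    Matrix.toEuclideanLin A x = ∑ j, x j • col A j := by
  ext r
  simp [Matrix.toLpLin_apply, Matrix.mulVec, dotProduct, col, mul_comm]

theorem aux_mrange {m p : ℕ} (A : Matrix (Fin m) (Fin p) 𝕜) :
    mrange A = Submodule.span 𝕜 (Set.range (col A)) := by
  ext y
  rw [Submodule.mem_span_range_iff_exists_fun]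
  constructor
  · rintro ⟨x, rfl⟩
    exact ⟨fun j => x j, (aux_toEuclideanLin A x).symm⟩
  · rintro ⟨c, rfl⟩
    exact ⟨WithLp.toLp 2 c, by rw [aux_toEuclideanLin]⟩

theorem aux_col_colSub {m n : ℕ} (A : Matrix (Fin m) (Fin n) 𝕜) (J : Finset (Fin n)) :
    col (colSub A J) = col A ∘ (J.orderEmbOfFin rfl) := rfl

theorem aux_mrange_colSub {m n : ℕ} (A : Matrix (Fin m) (Fin n) 𝕜) (J : Finset (Fin n)) :
    mrange (colSub A J) = Submodule.span 𝕜 (col A '' (J : Set (Fin n))) := by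
  rw [aux_mrange, aux_col_colSub, Set.range_comp, Finset.range_orderEmbOfFin]

theorem aux_col_ndotMat {m n : ℕ} (Φ : Matrix (Fin m) (Fin n) 𝕜) (Γ J : Finset (Fin n)) :
    col (ndotMat Φ Γ J) = ndot Φ Γ ∘ (J.orderEmbOfFin rfl) := rfl

theorem aux_mrange_ndotMat {m n : ℕ} (A : Matrix (Fin m) (Fin n) 𝕜) (Γ J : Finset (Fin n)) :
    mrange (ndotMat A Γ J) = Submodule.span 𝕜 (ndot A Γ '' (J : Set (Fin n))) := by
  rw [aux_mrange, aux_col_ndotMat, Set.range_comp, Finset.range_orderEmbOfFin]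

theorem aux_inj {m p : ℕ} (A : Matrix (Fin m) (Fin p) 𝕜) (h : 0 < sval A p) :
    LinearIndependent 𝕜 (col A) := by
  have : ∃ t ∈ { t : ℝ | 0 ≤ t ∧ ∃ S : Submodule 𝕜 (EuclideanSpace 𝕜 (Fin p)),
    Module.finrank 𝕜 S = p ∧ ∀ x ∈ S, t * ‖x‖ ≤ ‖Matrix.toEuclideanLin A x‖ }, 0 < t := by
    by_contra! hc
    exact absurd (Real.sSup_nonpos hc) (not_le.mpr h)
  obtain ⟨t, ⟨-, S, hS, hx⟩, ht⟩ := this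
  have hT : S = ⊤ := Submodule.eq_top_of_finrank_eq (by simp [hS])
  subst hT
  rw [Fintype.linearIndependent_iff]
  intro g hg i
  have := hx (WithLp.toLp 2 g) trivial
  rw [aux_toEuclideanLin] at this
  simp only at this
  rw [hg, norm_zero] at this
  have h0 : ‖WithLp.toLp 2 g‖ = 0 := by
    have := norm_nonneg (WithLp.toLp 2 g)
    nlinarith
  have h1 := norm_eq_zero.mp h0
  have h2 := congrArg (fun v : EuclideanSpace 𝕜 (Fin p) => v i) h1
  simpa using h2

theorem aux_proj_eq_zero {m : ℕ} (S : Submodule 𝕜 (EuclideanSpace 𝕜 (Fin m)))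
    (v : EuclideanSpace 𝕜 (Fin m)) : proj S v = 0 ↔ v ∈ Sᗮ := by
  simp [proj, Submodule.starProjection_apply_eq_zero_iff]

theorem aux_linIndep {m n : ℕ} (Φ : Matrix (Fin m) (Fin n) 𝕜) (Ω Γ : Finset (Fin n))
    (h : LinearIndependent 𝕜 (col (colSub Φ (Ω ∪ Γ)))) :
    LinearIndependent 𝕜 (col (ndotMat Φ Γ (Ω \ Γ))) := by
  have h1 : LinearIndepOn 𝕜 (col Φ) ((Ω ∪ Γ : Finset (Fin n)) : Set (Fin n)) := by
    rw [aux_col_colSub] at h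
    have := (linearIndepOn_range_iff ((Ω ∪ Γ).orderEmbOfFin rfl).injective (col Φ)).mpr h
    rwa [Finset.range_orderEmbOfFin] at this
  have h2 : ((Ω ∪ Γ : Finset (Fin n)) : Set (Fin n)) = ((Ω \ Γ : Finset (Fin n)) : Set (Fin n)) ∪ Γ := by
    rw [← Finset.coe_union]; simp
  have hd : Disjoint ((Ω \ Γ : Finset (Fin n)) : Set (Fin n)) Γ := by
    rw [Finset.disjoint_coe]; exact Finset.sdiff_disjoint
  rw [h2] at h1
  have h3 := (linearIndepOn_union_iff hd).mp h1
  have h4 : LinearIndependent 𝕜 (col Φ ∘ ((Ω \ Γ).orderEmbOfFin rfl)) := by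
    rw [← linearIndepOn_range_iff ((Ω \ Γ).orderEmbOfFin rfl).injective,
      Finset.range_orderEmbOfFin]
    exact h3.1
  have h5 := h4.map (f := (proj (mrange (colSub Φ Γ))ᗮ).toLinearMap) (by
    have : LinearMap.ker (proj (mrange (colSub Φ Γ))ᗮ).toLinearMap = mrange (colSub Φ Γ) := by
      ext v
      rw [LinearMap.mem_ker]
      refine (aux_proj_eq_zero _ v).trans ?_
      rw [Submodule.orthogonal_orthogonal]
    rw [this, aux_mrange_colSub, Set.range_comp, Finset.range_orderEmbOfFin]
    exact h3.2.2)
  have h6 : ∀ q, ((‖proj (mrange (colSub Φ Γ))ᗮ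
      (col Φ ((Ω \ Γ).orderEmbOfFin rfl q))‖⁻¹ : ℝ) : 𝕜) ≠ 0 := by
    intro q
    have := h5.ne_zero q
    simpa using this
  have h7 := h5.units_smul (fun q => Units.mk0 _ (h6 q))
  have e : col (ndotMat Φ Γ (Ω \ Γ)) = fun q => ((‖proj (mrange (colSub Φ Γ))ᗮ
      (col Φ ((Ω \ Γ).orderEmbOfFin rfl q))‖⁻¹ : ℝ) : 𝕜) •
      proj (mrange (colSub Φ Γ))ᗮ (col Φ ((Ω \ Γ).orderEmbOfFin rfl q)) := by
    funext q
    simp only [aux_col_ndotMat, Function.comp, ndot]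
    exact (algebraMap_smul 𝕜 _ _).symm
  rw [e]
  exact h7

theorem aux_span_s11 {m n l : ℕ} (Φ : Matrix (Fin m) (Fin n) 𝕜)
    (X₀ : Matrix (Fin n) (Fin l) 𝕜) (Ω Γ : Finset (Fin n))
    (Sbar : Submodule 𝕜 (EuclideanSpace 𝕜 (Fin m)))
    (hS : Sbar ≤ mrange (colSub Φ Ω * rowSub X₀ Ω)) :
    Sbar.map (proj (mrange (colSub Φ Γ))ᗮ).toLinearMap ≤ mrange (ndotMat Φ Γ (Ω \ Γ)) := by
  have h1 : mrange (colSub Φ Ω * rowSub X₀ Ω) ≤ mrange (colSub Φ Ω) := by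
    rintro _ ⟨x, rfl⟩
    exact ⟨Matrix.toEuclideanLin (rowSub X₀ Ω) x, by
      simp [Matrix.toLpLin_apply]⟩
  refine (Submodule.map_mono (hS.trans h1)).trans ?_
  rw [aux_mrange_colSub Φ Ω, Submodule.map_span, Submodule.span_le]
  rintro _ ⟨_, ⟨j, hj, rfl⟩, rfl⟩
  by_cases hz : proj (mrange (colSub Φ Γ))ᗮ (col Φ j) = 0
  · have : (proj (mrange (colSub Φ Γ))ᗮ).toLinearMap (col Φ j) = 0 := hz
    rw [this]; exact Submodule.zero_mem _
  have hjΓ : j ∉ Γ := by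
    intro hjΓ
    apply hz
    rw [aux_proj_eq_zero, Submodule.orthogonal_orthogonal, aux_mrange_colSub]
    exact Submodule.subset_span ⟨j, hjΓ, rfl⟩
  rw [aux_mrange_ndotMat]
  have h2 : ndot Φ Γ j ∈ Submodule.span 𝕜 (ndot Φ Γ '' ((Ω \ Γ : Finset (Fin n)) : Set (Fin n))) :=
    Submodule.subset_span ⟨j, by simpa using ⟨hj, hjΓ⟩, rfl⟩
  have h3 := Submodule.smul_mem _ ((‖proj (mrange (colSub Φ Γ))ᗮ (col Φ j)‖ : ℝ) : 𝕜) h2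
  convert h3 using 1
  have h4 : ((‖proj (mrange (colSub Φ Γ))ᗮ (col Φ j)‖ : ℝ) : 𝕜) • ndot Φ Γ j
      = ‖proj (mrange (colSub Φ Γ))ᗮ (col Φ j)‖ • ndot Φ Γ j := algebraMap_smul 𝕜 _ _
  rw [h4, ndot, smul_smul, mul_inv_cancel₀ (norm_ne_zero_iff.mpr hz), one_smul]
  rfl

open scoped ComplexOrder in
theorem aux_pinv_orth {m p : ℕ} (A : Matrix (Fin m) (Fin p) 𝕜)
    (h : LinearIndependent 𝕜 (col A)) (v : EuclideanSpace 𝕜 (Fin m)) :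
    v - ∑ q, (pinv A).mulVec (fun r => v r) q • col A q ∈ (mrange A)ᗮ := by
  have hu : IsUnit (Aᴴ * A) := by
    rw [← Matrix.mulVec_injective_iff_isUnit]
    rw [← Matrix.coe_mulVecLin, ← LinearMap.ker_eq_bot, LinearMap.ker_eq_bot']
    intro x hx
    rw [Matrix.mulVecLin_apply, Matrix.conjTranspose_mul_self_mulVec_eq_zero] at hx
    rw [Fintype.linearIndependent_iff] at h
    funext i
    refine h x ?_ i
    rw [← aux_toEuclideanLin A (WithLp.toLp 2 x)]
    simp [Matrix.toLpLin_apply, hx]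
  have hu' := (Matrix.isUnit_iff_isUnit_det _).mp hu
  have key : Aᴴ.mulVec (fun r => v r) =
      Aᴴ.mulVec (A.mulVec ((pinv A).mulVec (fun r => v r))) := by
    rw [Matrix.mulVec_mulVec, Matrix.mulVec_mulVec, pinv, ← Matrix.mul_assoc,
      Matrix.mul_nonsing_inv _ hu', Matrix.one_mul]
  generalize (pinv A).mulVec (fun r => v r) = w at key ⊢
  rw [aux_mrange, Submodule.mem_orthogonal]
  intro u hmem
  induction hmem using Submodule.span_induction with
  | mem x hx =>
    obtain ⟨q, rfl⟩ := hx
    rw [← aux_toEuclideanLin A (WithLp.toLp 2 w), inner_sub_right,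
      sub_eq_zero]
    have := congrFun key q
    simp only [Matrix.mulVec, dotProduct, Matrix.conjTranspose_apply] at this
    simpa [PiLp.inner_apply, col, Matrix.toLpLin_apply, Matrix.mulVec, dotProduct, mul_comm] using this
  | zero => simp
  | add x y _ _ hx hy => rw [inner_add_left, hx, hy, add_zero]
  | smul a x _ hx => rw [inner_smul_left, hx, mul_zero]

/-- The largest projection norm over the off-support indices
is bounded by the product of the maximal ℓ₁ norm `‖Φ̇_{Ω\Γ}† φ̇_i‖₁` and the
largest projection norm over `Ω \ Γ`. -/
theorem statement11 {m n l k r : ℕ} (Φ : Matrix (Fin m) (Fin n) 𝕜)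
    (X₀ : Matrix (Fin n) (Fin l) 𝕜) (Ω Γ : Finset (Fin n))
    (hΩ : rowSupport X₀ = Ω) (hk : Ω.card ≤ k)
    (hΓ : Γ ≠ Finset.univ)
    (Sbar : Submodule 𝕜 (EuclideanSpace 𝕜 (Fin m)))
    (hS : Sbar ≤ mrange (colSub Φ Ω * rowSub X₀ Ω))
    (hr : Module.finrank 𝕜 Sbar = r)
    (hσ : 0 < sval (colSub Φ (Ω ∪ Γ)) (Ω ∪ Γ).card) :
    ∀ i, i ∉ Ω ∪ Γ →
      ‖proj (Sbar.map (proj (mrange (colSub Φ Γ))ᗮ).toLinearMap) (ndot Φ Γ i)‖ ≤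
        (sSup {x : ℝ | ∃ i', i' ∉ Ω ∪ Γ ∧
            x = ∑ q, ‖(pinv (ndotMat Φ Γ (Ω \ Γ))).mulVec (fun r => ndot Φ Γ i' r) q‖}) *
          (sSup {x : ℝ | ∃ l₀ ∈ Ω \ Γ,
            x = ‖proj (Sbar.map (proj (mrange (colSub Φ Γ))ᗮ).toLinearMap) (ndot Φ Γ l₀)‖}) := by
  intro i hi
  set T := Sbar.map (proj (mrange (colSub Φ Γ))ᗮ).toLinearMap with hT
  have hli := aux_linIndep Φ Ω Γ (aux_inj _ hσ)
  have horth := aux_pinv_orth _ hli (ndot Φ Γ i)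
  have hTle := aux_span_s11 Φ X₀ Ω Γ Sbar hS
  have h0 := (aux_proj_eq_zero T _).mpr (Submodule.orthogonal_le hTle horth)
  rw [map_sub, sub_eq_zero, map_sum] at h0
  have hfin1 : {x : ℝ | ∃ i', i' ∉ Ω ∪ Γ ∧
            x = ∑ q, ‖(pinv (ndotMat Φ Γ (Ω \ Γ))).mulVec (fun r => ndot Φ Γ i' r) q‖}.Finite := by
    refine (Set.finite_range (fun i' : Fin n =>
      ∑ q, ‖(pinv (ndotMat Φ Γ (Ω \ Γ))).mulVec (fun r => ndot Φ Γ i' r) q‖)).subset ?_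
    rintro _ ⟨i', -, rfl⟩
    exact ⟨i', rfl⟩
  have hfin2 : {x : ℝ | ∃ l₀ ∈ Ω \ Γ, x = ‖proj T (ndot Φ Γ l₀)‖}.Finite := by
    refine (Set.finite_range (fun i' : Fin n => ‖proj T (ndot Φ Γ i')‖)).subset ?_
    rintro _ ⟨i', -, rfl⟩
    exact ⟨i', rfl⟩
  have hnn : 0 ≤ sSup {x : ℝ | ∃ l₀ ∈ Ω \ Γ, x = ‖proj T (ndot Φ Γ l₀)‖} := by
    apply Real.sSup_nonneg
    rintro _ ⟨_, -, rfl⟩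
    exact norm_nonneg _
  calc ‖proj T (ndot Φ Γ i)‖
      ≤ ∑ q, ‖proj T ((pinv (ndotMat Φ Γ (Ω \ Γ))).mulVec (fun r => ndot Φ Γ i r) q •
          col (ndotMat Φ Γ (Ω \ Γ)) q)‖ := by
        conv_lhs => rw [h0]
        exact norm_sum_le _ _
    _ ≤ ∑ q, ‖(pinv (ndotMat Φ Γ (Ω \ Γ))).mulVec (fun r => ndot Φ Γ i r) q‖ *
          sSup {x : ℝ | ∃ l₀ ∈ Ω \ Γ, x = ‖proj T (ndot Φ Γ l₀)‖} := by
        refine Finset.sum_le_sum fun q _ => ?_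
        rw [map_smul, norm_smul]
        refine mul_le_mul_of_nonneg_left ?_ (norm_nonneg _)
        exact le_csSup hfin2.bddAbove ⟨_, Finset.orderEmbOfFin_mem _ rfl q, rfl⟩
    _ = (∑ q, ‖(pinv (ndotMat Φ Γ (Ω \ Γ))).mulVec (fun r => ndot Φ Γ i r) q‖) *
          sSup {x : ℝ | ∃ l₀ ∈ Ω \ Γ, x = ‖proj T (ndot Φ Γ l₀)‖} := by
        rw [Finset.sum_mul]
    _ ≤ _ := mul_le_mul_of_nonneg_right (le_csSup hfin1.bddAbove ⟨i, hi, rfl⟩) hnn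
end
end
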